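/- arXiv:1212.6595 — 3 statements merged into one kernel-verified Lean document; each statement's English description precedes it below -/
import Mathlib

section
/- Let U be a smooth real function on an open interval I, let Ẽ_1, …, Ẽ_M be real constants, and let φ_1, …, φ_M be smooth real functions on I satisfying −φ_j'' + Uφ_j = Ẽ_jφ_j on I for j = 1, …, M. Assume that for each s = 1, …, M the Wronskian W[φ_1, …, φ_s](x) is nonvanishing on I. Then for each j = 1, …, M, the function φ̆_j^{[M]}(x) = W[φ_1, …, φ̂_j, …, φ_M](x) / W[φ_1, …, φ_M](x) (the hat meaning φ_j is omitted from the Wronskian) satisfies −(φ̆_j^{[M]})'' + U^{[M]}φ̆_j^{[M]} = Ẽ_j·φ̆_j^{[M]} on I, where U^{[M]}(x) = U(x) − 2·d²/dx² log|W[φ_1, …, φ_M](x)|. -/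
/-- The Wronskian of `n` real functions: `W[f₁,…,fₙ](x) = det(f_k^{(j-1)}(x))`. -/
noncomputable def wronskian (n : ℕ) (f : Fin n → ℝ → ℝ) (x : ℝ) : ℝ :=
  Matrix.det (Matrix.of fun j k : Fin n => iteratedDeriv (j : ℕ) (f k) x)

open Matrix in
/-- The derivative of a determinant is the sum over the columns of the determinants in which
that column has been differentiated. -/
theorem hasDerivAt_det_updateCol {n : ℕ} {A : ℝ → Matrix (Fin n) (Fin n) ℝ}
    {A' : Matrix (Fin n) (Fin n) ℝ} {x : ℝ}
    (hA : ∀ i k, HasDerivAt (fun y => A y i k) (A' i k) x) :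
    HasDerivAt (fun y => (A y).det) (∑ k, ((A x).updateCol k fun i => A' i k).det) x := by
  simp only [det_apply']
  rw [Finset.sum_comm]
  refine HasDerivAt.fun_sum fun σ _ => ?_
  rw [← Finset.mul_sum]
  refine HasDerivAt.const_mul _ ?_
  convert HasDerivAt.fun_finsetProd (u := Finset.univ) fun k _ => hA (σ k) k using 1
  refine Finset.sum_congr rfl fun k _ => ?_
  rw [← Finset.mul_prod_erase _ _ (Finset.mem_univ k), smul_eq_mul, mul_comm]
  congr 1
  · refine Finset.prod_congr rfl fun l hl => ?_
    rw [updateCol_ne (Finset.ne_of_mem_erase hl)]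
  · simp

open Matrix in
/-- The derivative of a determinant is the sum over the rows of the determinants in which
that row has been differentiated. -/
theorem hasDerivAt_det_updateRow {n : ℕ} {A : ℝ → Matrix (Fin n) (Fin n) ℝ}
    {A' : Matrix (Fin n) (Fin n) ℝ} {x : ℝ}
    (hA : ∀ i k, HasDerivAt (fun y => A y i k) (A' i k) x) :
    HasDerivAt (fun y => (A y).det) (∑ i, ((A x).updateRow i (A' i)).det) x := by
  have h := hasDerivAt_det_updateCol (A := fun y => (A y)ᵀ) (A' := A'ᵀ) fun i k => hA k i
  simp only [det_transpose, updateCol_transpose] at h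
  exact h

theorem ContDiffOn.iteratedDeriv_of_isOpen {s : Set ℝ} (hs : IsOpen s) {f : ℝ → ℝ}
    (hf : ContDiffOn ℝ (⊤ : ℕ∞) f s) (n : ℕ) :
    ContDiffOn ℝ (⊤ : ℕ∞) (iteratedDeriv n f) s := by
  induction n with
  | zero => simpa using hf
  | succ n ih =>
    rw [iteratedDeriv_succ]
    exact ih.deriv_of_isOpen hs (by simp)

theorem ContDiffOn.hasDerivAt_of_isOpen {s : Set ℝ} (hs : IsOpen s) {f : ℝ → ℝ}
    (hf : ContDiffOn ℝ (⊤ : ℕ∞) f s) {x : ℝ} (hx : x ∈ s) :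
    HasDerivAt f (deriv f x) x :=
  ((hf.contDiffAt (hs.mem_nhds hx)).differentiableAt (by simp)).hasDerivAt

theorem ContDiffOn.hasDerivAt_iteratedDeriv {s : Set ℝ} (hs : IsOpen s) {f : ℝ → ℝ}
    (hf : ContDiffOn ℝ (⊤ : ℕ∞) f s) (n : ℕ) {x : ℝ} (hx : x ∈ s) :
    HasDerivAt (iteratedDeriv n f) (iteratedDeriv (n + 1) f x) x := by
  rw [iteratedDeriv_succ]
  exact (hf.iteratedDeriv_of_isOpen hs n).hasDerivAt_of_isOpen hs hx

theorem contDiffOn_wronskian {s : Set ℝ} (hs : IsOpen s) {n : ℕ} {f : Fin n → ℝ → ℝ}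
    (hf : ∀ k, ContDiffOn ℝ (⊤ : ℕ∞) (f k) s) :
    ContDiffOn ℝ (⊤ : ℕ∞) (wronskian n f) s := by
  unfold wronskian
  simp only [Matrix.det_apply', Matrix.of_apply]
  exact ContDiffOn.sum fun σ _ => contDiffOn_const.mul <|
    contDiffOn_prod fun k _ => (hf k).iteratedDeriv_of_isOpen hs _

/-- Laplace expansion along the last row of the Wronskian matrix with that row replaced
by `v`. -/
theorem det_updateRow_last_wronskian {m : ℕ} (f : Fin (m + 1) → ℝ → ℝ) (v : Fin (m + 1) → ℝ)
    (x : ℝ) :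
    ((Matrix.of fun j k : Fin (m + 1) => iteratedDeriv (j : ℕ) (f k) x).updateRow
        (Fin.last m) v).det =
      ∑ k : Fin (m + 1), (-1) ^ (m + (k : ℕ)) * wronskian m (fun i => f (k.succAbove i)) x
        * v k := by
  rw [Matrix.det_succ_row _ (Fin.last m)]
  refine Finset.sum_congr rfl fun k _ => ?_
  have : ((Matrix.of fun j k : Fin (m + 1) => iteratedDeriv (j : ℕ) (f k) x).updateRow
        (Fin.last m) v).submatrix (Fin.last m).succAbove k.succAbove =
      Matrix.of fun j i : Fin m => iteratedDeriv (j : ℕ) (f (k.succAbove i)) x := by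
    ext j i
    simp
  rw [this, wronskian]
  simp
  ring

/-- The maximal minors of the Wronskian matrix annihilate the derivatives of order `< m` and
pair with those of order `m` to the Wronskian. -/
theorem sum_wronskian_succAbove_mul_iteratedDeriv {m : ℕ} (f : Fin (m + 1) → ℝ → ℝ) (x : ℝ)
    {i : ℕ} (hi : i ≤ m) :
    ∑ k : Fin (m + 1), (-1) ^ (m + (k : ℕ)) * wronskian m (fun l => f (k.succAbove l)) x
        * iteratedDeriv i (f k) x = if i = m then wronskian (m + 1) f x else 0 := by
  rw [← det_updateRow_last_wronskian f (fun k => iteratedDeriv i (f k) x)]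
  split_ifs with h
  · subst h
    rw [wronskian]
    congr 1
    ext j k
    by_cases hj : j = Fin.last i
    · subst hj; simp
    · simp [Matrix.updateRow_ne hj]
  · have hne : (⟨i, by omega⟩ : Fin (m + 1)) ≠ Fin.last m := by simpa [Fin.ext_iff] using h
    refine Matrix.det_zero_of_row_eq hne ?_
    rw [Matrix.updateRow_ne hne, Matrix.updateRow_self]
    rfl

theorem hasDerivAt_wronskian {s : Set ℝ} (hs : IsOpen s) {m : ℕ} {f : Fin (m + 1) → ℝ → ℝ}
    (hf : ∀ k, ContDiffOn ℝ (⊤ : ℕ∞) (f k) s) {x : ℝ} (hx : x ∈ s) :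
    HasDerivAt (wronskian (m + 1) f)
      (∑ k : Fin (m + 1), (-1) ^ (m + (k : ℕ)) * wronskian m (fun l => f (k.succAbove l)) x
        * iteratedDeriv (m + 1) (f k) x) x := by
  have h := hasDerivAt_det_updateRow
    (A := fun y => Matrix.of fun j k : Fin (m + 1) => iteratedDeriv (j : ℕ) (f k) y)
    (A' := Matrix.of fun j k : Fin (m + 1) => iteratedDeriv ((j : ℕ) + 1) (f k) x) (x := x)
    fun j k => (hf k).hasDerivAt_iteratedDeriv hs j hx
  rw [← det_updateRow_last_wronskian f (fun k => iteratedDeriv (m + 1) (f k) x)]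
  rw [Finset.sum_eq_single (Fin.last m)] at h
  · exact h
  · intro j _ hj
    have hlt : (j : ℕ) < m := Fin.val_lt_last hj
    have hne : (⟨j + 1, by omega⟩ : Fin (m + 1)) ≠ j := by simp [Fin.ext_iff]
    refine Matrix.det_zero_of_row_eq hne ?_
    rw [Matrix.updateRow_ne hne, Matrix.updateRow_self]
    rfl
  · simp

/-- If the functions `c k` are dual to the top row of the Wronskian matrix of solutions
`f k` of `f'' = (U - E) f`, then they solve the deformed equation. -/
theorem deriv_deriv_of_dual {s : Set ℝ} (hs : IsOpen s) {m : ℕ} {U : ℝ → ℝ}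
    {f c : Fin (m + 1) → ℝ → ℝ} {E : Fin (m + 1) → ℝ}
    (hU : ContDiffOn ℝ (⊤ : ℕ∞) U s)
    (hf : ∀ k, ContDiffOn ℝ (⊤ : ℕ∞) (f k) s) (hc : ∀ k, ContDiffOn ℝ (⊤ : ℕ∞) (c k) s)
    (hE : ∀ k, ∀ x ∈ s, deriv (deriv (f k)) x = U x * f k x - E k * f k x)
    (hW : ∀ x ∈ s, wronskian (m + 1) f x ≠ 0)
    (hdual : ∀ x ∈ s, ∀ i ≤ m,
      ∑ k, c k x * iteratedDeriv i (f k) x = if i = m then 1 else 0)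
    {x : ℝ} (hx : x ∈ s) (j : Fin (m + 1)) :
    deriv (deriv (c j)) x = (U x - E j
      - 2 * deriv (fun y => ∑ k, c k y * iteratedDeriv (m + 1) (f k) y) x) * c j x := by
  set g : ℕ → ℝ → ℝ := fun i y => ∑ k, c k y * iteratedDeriv i (f k) y with hg
  set t := deriv (g (m + 1)) x with ht
  have hc' : ∀ k, ContDiffOn ℝ (⊤ : ℕ∞) (deriv (c k)) s := fun k =>
    (hc k).deriv_of_isOpen hs (by simp)
  have hgder : ∀ i, ∀ y ∈ s, deriv (g i) y =
      (∑ k, deriv (c k) y * iteratedDeriv i (f k) y) + g (i + 1) y := by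
    intro i y hy
    rw [hg, ← Finset.sum_add_distrib]
    exact (HasDerivAt.fun_sum fun k _ => ((hc k).hasDerivAt_of_isOpen hs hy).mul
      ((hf k).hasDerivAt_iteratedDeriv hs i hy)).deriv
  have hgm : ∀ i ≤ m, ∀ y ∈ s, g i y = if i = m then 1 else 0 := fun i hi y hy => hdual y hy i hi
  have hgm' : ∀ i ≤ m, ∀ y ∈ s, deriv (g i) y = 0 := by
    intro i hi y hy
    have : g i =ᶠ[nhds y] fun _ => if i = m then 1 else 0 := by
      filter_upwards [hs.mem_nhds hy] with z hz using hgm i hi z hz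
    rw [this.deriv_eq]
    simp
  have hsecond : ∀ i ≤ m, ∑ k, deriv (deriv (c k)) x * iteratedDeriv i (f k) x =
      g (i + 2) x - 2 * t * g i x := by
    intro i hi
    have h1 : HasDerivAt (fun y => ∑ k, deriv (c k) y * iteratedDeriv i (f k) y)
        (∑ k, (deriv (deriv (c k)) x * iteratedDeriv i (f k) x +
          deriv (c k) x * iteratedDeriv (i + 1) (f k) x)) x :=
      HasDerivAt.fun_sum fun k _ => ((hc' k).hasDerivAt_of_isOpen hs hx).mul
        ((hf k).hasDerivAt_iteratedDeriv hs i hx)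
    have h2 : (fun y => ∑ k, deriv (c k) y * iteratedDeriv i (f k) y) =ᶠ[nhds x]
        fun y => -g (i + 1) y := by
      filter_upwards [hs.mem_nhds hx] with y hy
      have := hgder i y hy
      rw [hgm' i hi y hy] at this
      linarith
    have h3 := h1.deriv
    rw [h2.deriv_eq, deriv.fun_neg, Finset.sum_add_distrib] at h3
    have h4 := hgder (i + 1) x hx
    have h5 : deriv (g (i + 1)) x = t * g i x := by
      rw [hgm i hi x hx]
      split_ifs with h
      · subst h; simp [ht]
      · rw [hgm' (i + 1) (by omega) x hx]; simp
    rw [add_assoc] at h4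
    norm_num at h4
    linarith
  have hiter : ∀ i k, iteratedDeriv (i + 2) (f k) x =
      (∑ l ∈ Finset.range (i + 1), i.choose l * iteratedDeriv l U x
        * iteratedDeriv (i - l) (f k) x) - E k * iteratedDeriv i (f k) x := by
    intro i k
    have hUx : ContDiffAt ℝ i U x :=
      (hU.contDiffAt (hs.mem_nhds hx)).of_le (by exact_mod_cast le_top)
    have hfx : ContDiffAt ℝ i (f k) x :=
      ((hf k).contDiffAt (hs.mem_nhds hx)).of_le (by exact_mod_cast le_top)
    have h : deriv (deriv (f k)) =ᶠ[nhds x] (U * f k) - (fun y => E k * f k y) := by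
      filter_upwards [hs.mem_nhds hx] with y hy using hE k y hy
    rw [iteratedDeriv_succ', iteratedDeriv_succ', h.iteratedDeriv_eq,
      iteratedDeriv_sub (f := U * f k) (hUx.mul hfx) (contDiffAt_const.mul hfx),
      iteratedDeriv_mul hUx hfx,
      iteratedDeriv_const_mul_field]
  have hshift : ∀ i ≤ m, g (i + 2) x =
      U x * g i x - ∑ k, E k * c k x * iteratedDeriv i (f k) x := by
    intro i hi
    have h1 : g (i + 2) x = (∑ l ∈ Finset.range (i + 1), i.choose l * iteratedDeriv l U x
        * g (i - l) x) - ∑ k, E k * c k x * iteratedDeriv i (f k) x := by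
      simp only [hg, hiter, mul_sub, Finset.mul_sum, Finset.sum_sub_distrib]
      rw [Finset.sum_comm]
      congr 1
      · exact Finset.sum_congr rfl fun l _ => Finset.sum_congr rfl fun k _ => by ring
      · exact Finset.sum_congr rfl fun k _ => by ring
    rw [h1, Finset.sum_eq_single 0]
    · simp
    · intro l hl hl0
      rw [hgm (i - l) (by omega) x hx, if_neg (by rw [Finset.mem_range] at hl; omega), mul_zero]
    · simp
  have hzero : (Matrix.of fun j k : Fin (m + 1) => iteratedDeriv (j : ℕ) (f k) x).mulVec
      (fun k => deriv (deriv (c k)) x - (U x - E k - 2 * t) * c k x) = 0 := by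
    ext i
    have hi : (i : ℕ) ≤ m := by omega
    have h1 := hsecond i hi
    rw [hshift i hi] at h1
    simp only [Matrix.mulVec, dotProduct, Matrix.of_apply, Pi.zero_apply]
    have h2 : ∀ k, iteratedDeriv (i : ℕ) (f k) x *
        (deriv (deriv (c k)) x - (U x - E k - 2 * t) * c k x) =
        deriv (deriv (c k)) x * iteratedDeriv (i : ℕ) (f k) x
          - (U x - 2 * t) * (c k x * iteratedDeriv (i : ℕ) (f k) x)
          + E k * c k x * iteratedDeriv (i : ℕ) (f k) x := fun k => by ring
    simp only [h2, Finset.sum_add_distrib, Finset.sum_sub_distrib, ← Finset.mul_sum, h1, hg]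
    ring
  have := congrFun (Matrix.eq_zero_of_mulVec_eq_zero (hW x hx) hzero) j
  simpa [sub_eq_zero] using this

/-- the extra solutions of the M-step Darboux-Crum deformed operator,
`φ̆ⱼ^{[M]} = W[φ₁,…,φ̂ⱼ,…,φ_M]/W[φ₁,…,φ_M]`, with the energies of the deleted seeds.
Here `M = m + 1` and the `j`-th seed is omitted via `Fin.succAbove`. -/
theorem darboux_crum_deleted_seed_solution
    (a b : ℝ) (m : ℕ) (U : ℝ → ℝ) (φ : Fin (m + 1) → ℝ → ℝ) (Et : Fin (m + 1) → ℝ)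
    (hU : ContDiffOn ℝ (⊤ : ℕ∞) U (Set.Ioo a b))
    (hφ : ∀ j, ContDiffOn ℝ (⊤ : ℕ∞) (φ j) (Set.Ioo a b))
    (heφ : ∀ j, ∀ x ∈ Set.Ioo a b,
      -(deriv (deriv (φ j)) x) + U x * φ j x = Et j * φ j x)
    (hW : ∀ s, 1 ≤ s → ∀ hs : s ≤ m + 1, ∀ x ∈ Set.Ioo a b,
      wronskian s (fun i => φ (Fin.castLE hs i)) x ≠ 0)
    (j : Fin (m + 1)) :
    ∀ x ∈ Set.Ioo a b,
      -(deriv (deriv (fun y =>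
          wronskian m (fun i => φ (j.succAbove i)) y / wronskian (m + 1) φ y)) x)
        + (U x - 2 * deriv (deriv (fun y => Real.log |wronskian (m + 1) φ y|)) x)
          * (wronskian m (fun i => φ (j.succAbove i)) x / wronskian (m + 1) φ x)
      = Et j * (wronskian m (fun i => φ (j.succAbove i)) x
                  / wronskian (m + 1) φ x) := by
  intro x hx
  have hs : IsOpen (Set.Ioo a b) := isOpen_Ioo
  have hW0 : ∀ y ∈ Set.Ioo a b, wronskian (m + 1) φ y ≠ 0 := hW (m + 1) (by omega) le_rfl
  set W := wronskian (m + 1) φ with hWdef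
  set V : Fin (m + 1) → ℝ → ℝ := fun k => wronskian m (fun i => φ (k.succAbove i)) with hV
  set c : Fin (m + 1) → ℝ → ℝ := fun k y => (-1) ^ (m + (k : ℕ)) * (V k y / W y) with hc
  have hsum : ∀ i, ∀ y ∈ Set.Ioo a b, ∑ k, c k y * iteratedDeriv i (φ k) y =
      (∑ k : Fin (m + 1), (-1) ^ (m + (k : ℕ)) * V k y * iteratedDeriv i (φ k) y) / W y := by
    intro i y _
    rw [Finset.sum_div]
    exact Finset.sum_congr rfl fun k _ => by simp only [hc]; ring
  have hcs : ∀ k, ContDiffOn ℝ (⊤ : ℕ∞) (c k) (Set.Ioo a b) := fun k =>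
    contDiffOn_const.mul ((contDiffOn_wronskian hs fun i => hφ _).div
      (contDiffOn_wronskian hs hφ) hW0)
  have key := deriv_deriv_of_dual (E := Et) hs hU hφ hcs
    (fun k y hy => by linarith [heφ k y hy]) hW0
    (fun y hy i hi => by
      rw [hsum i y hy, sum_wronskian_succAbove_mul_iteratedDeriv φ y hi]
      split_ifs
      · exact div_self (hW0 y hy)
      · simp) hx j
  have hlog : deriv (fun y => Real.log |W y|) =ᶠ[nhds x]
      fun y => ∑ k, c k y * iteratedDeriv (m + 1) (φ k) y := by
    filter_upwards [hs.mem_nhds hx] with y hy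
    simp only [Real.log_abs]
    rw [hsum (m + 1) y hy]
    exact ((hasDerivAt_wronskian hs hφ hy).log (hW0 y hy)).deriv
  rw [← hlog.deriv_eq] at key
  have hsign : ((-1 : ℝ) ^ (m + (j : ℕ))) ≠ 0 := pow_ne_zero _ (by norm_num)
  have hcj : deriv (deriv (c j)) x =
      (-1) ^ (m + (j : ℕ)) * deriv (deriv fun y => V j y / W y) x := by
    simp only [hc, deriv_const_mul_field']
  rw [hcj] at key
  have key' : deriv (deriv fun y => V j y / W y) x =
      (U x - Et j - 2 * deriv (deriv fun y => Real.log |W y|) x) * (V j x / W x) := by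
    apply mul_left_cancel₀ hsign
    rw [key]
    ring
  rw [key']
  ring
end

section
/- Let d_1, …, d_M be distinct non-negative integers, let N be an integer with N ≥ max_j d_j, let e_1 < … < e_{N+1−M} be the elements of {0, 1, …, N} \ {N−d_1, …, N−d_M}, and let n be a non-negative integer. Set φ_k(x) = e^{−x²/2}·H_k(x) and φ̃_v(x) = e^{x²/2}·h̃_v(x). Then there exists a nonzero real constant c such that for all real x, W[φ̃_{d_1}, …, φ̃_{d_M}, φ_n](x) · W[φ_{e_1}, …, φ_{e_{N+1−M}}](x) = c · W[φ_{e_1}, …, φ_{e_{N+1−M}}, φ_{N+1+n}](x) · W[φ̃_{d_1}, …, φ̃_{d_M}](x). -/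
open Polynomial

/-- Physicists' Hermite polynomials: `H₀ = 1`, `H_{n+1} = 2x·Hₙ − Hₙ'`. -/
noncomputable def hermiteH : ℕ → Polynomial ℝ
  | 0 => 1
  | n + 1 => 2 * X * hermiteH n - Polynomial.derivative (hermiteH n)

/-- Twisted Hermite polynomials `h̃_v(x) = i^{−v} H_v(ix)`:
`h̃₀ = 1`, `h̃_{v+1} = 2x·h̃_v + h̃_v'`. -/
noncomputable def hermiteTwist : ℕ → Polynomial ℝ
  | 0 => 1
  | v + 1 => 2 * X * hermiteTwist v + Polynomial.derivative (hermiteTwist v)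

/-- Harmonic oscillator eigenfunctions `φ_k(x) = e^{−x²/2}·H_k(x)`. -/
noncomputable def phiEigen (k : ℕ) (x : ℝ) : ℝ :=
  Real.exp (-(x ^ 2) / 2) * (hermiteH k).eval x

/-- Pseudo virtual state wavefunctions `φ̃_v(x) = e^{x²/2}·h̃_v(x)`. -/
noncomputable def phiTilde (v : ℕ) (x : ℝ) : ℝ :=
  Real.exp (x ^ 2 / 2) * (hermiteTwist v).eval x

theorem wronskian_const_mul (k : ℕ) (c : Fin k → ℝ) (f : Fin k → ℝ → ℝ) (x : ℝ) :
    wronskian k (fun i y => c i * f i y) x = (∏ i, c i) * wronskian k f x := by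
  unfold _root_.wronskian
  rw [← Matrix.det_mul_row]
  congr 1
  ext j i
  simp only [Matrix.of_apply]
  exact iteratedDeriv_const_mul_field (c i) (f i)

theorem wronskian_mul_left (k : ℕ) (g : ℝ → ℝ) (hg : ContDiff ℝ (⊤ : ℕ∞) g)
    (f : Fin k → ℝ → ℝ) (hf : ∀ i, ContDiff ℝ (⊤ : ℕ∞) (f i)) (x : ℝ) :
    wronskian k (fun i y => g y * f i y) x = g x ^ k * wronskian k f x := by
  let L : Matrix (Fin k) (Fin k) ℝ := Matrix.of fun j l =>
    ((j : ℕ).choose l : ℝ) * iteratedDeriv ((j : ℕ) - l) g x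
  have hL : L.det = g x ^ k := by
    rw [Matrix.det_of_isLowerTriangular]
    · simp [L]
    · intro i j hij
      have : (i : ℕ) < j := hij
      simp [L, Nat.choose_eq_zero_of_lt this]
  unfold _root_.wronskian
  rw [← hL, ← Matrix.det_mul]
  congr 1
  ext j i
  have hk : (j : ℕ) + 1 ≤ k := j.2
  have hle : ((j : ℕ) : WithTop ℕ∞) ≤ ((⊤ : ℕ∞) : WithTop ℕ∞) := by
    exact_mod_cast le_top
  rw [Matrix.mul_apply]
  simp only [Matrix.of_apply, L]
  have h := iteratedDeriv_fun_mul (n := (j : ℕ)) (x := x) (f := f i) (g := g)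
    ((hf i).contDiffAt.of_le hle) (hg.contDiffAt.of_le hle)
  simp_rw [mul_comm (g _)]
  rw [h, Fin.sum_univ_eq_sum_range (fun l => ((j : ℕ).choose l : ℝ) *
    iteratedDeriv ((j : ℕ) - l) g x * iteratedDeriv l (f i) x) k]
  rw [← Finset.sum_subset (Finset.range_mono hk)]
  · exact Finset.sum_congr rfl fun l _ => by ring
  · intro l _ hl
    have : (j : ℕ) < l := by simpa using hl
    simp [Nat.choose_eq_zero_of_lt this]

theorem wronskian_cons_one (k : ℕ) (f : Fin k → ℝ → ℝ) (x : ℝ) :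
    wronskian (k + 1) (Fin.cons (fun _ => 1) f) x = wronskian k (fun i => deriv (f i)) x := by
  unfold _root_.wronskian
  rw [Matrix.det_succ_column_zero, Fin.sum_univ_succ]
  have h0 : ∀ i : Fin k, iteratedDeriv ((i.succ : Fin (k + 1)) : ℕ) (fun _ : ℝ => (1 : ℝ)) x = 0 := by
    intro i
    simp [iteratedDeriv_const]
  simp only [Matrix.of_apply, Fin.cons_zero, h0]
  simp only [Fin.val_zero, pow_zero, iteratedDeriv_zero, mul_zero, zero_mul,
    Finset.sum_const_zero, add_zero, one_mul]
  congr 1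
  ext j i
  simp [Matrix.submatrix_apply, iteratedDeriv_succ']

theorem wronskian_cons_of_gauge (k : ℕ) (g : ℝ → ℝ) (hg : ContDiff ℝ (⊤ : ℕ∞) g)
    (f₀ : ℝ → ℝ) (hf₀ : ContDiff ℝ (⊤ : ℕ∞) f₀) (h₀ : ∀ x, g x * f₀ x = 1)
    (f : Fin k → ℝ → ℝ) (hf : ∀ i, ContDiff ℝ (⊤ : ℕ∞) (f i))
    (h : Fin k → ℝ → ℝ) (hh : ∀ i, ContDiff ℝ (⊤ : ℕ∞) (h i)) (c : Fin k → ℝ)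
    (hder : ∀ i, deriv (fun y => g y * f i y) = fun y => c i * (g y * h i y)) (x : ℝ) :
    g x * wronskian (k + 1) (Fin.cons f₀ f) x = (∏ i, c i) * wronskian k h x := by
  have hgx : g x ≠ 0 := left_ne_zero_of_mul (h₀ x ▸ one_ne_zero)
  have key := wronskian_mul_left (k + 1) g hg (Fin.cons f₀ f : Fin (k + 1) → ℝ → ℝ)
    (by intro i; refine Fin.cases ?_ ?_ i
        · simpa using hf₀
        · intro j; simpa using hf j) x
  have hcons : (fun i y => g y * (Fin.cons f₀ f : Fin (k + 1) → ℝ → ℝ) i y) =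
      (Fin.cons (fun _ => 1) (fun i y => g y * f i y) : Fin (k + 1) → ℝ → ℝ) := by
    funext i
    refine Fin.cases ?_ ?_ i
    · funext y
      simp [h₀]
    · intro j
      simp
  rw [hcons, wronskian_cons_one] at key
  simp_rw [hder] at key
  rw [wronskian_const_mul k c (fun i y => g y * h i y),
    wronskian_mul_left k g hg h hh] at key
  apply mul_left_cancel₀ (pow_ne_zero k hgx)
  linear_combination -key

theorem wronskian_comp_perm (k : ℕ) (σ : Equiv.Perm (Fin k)) (f : Fin k → ℝ → ℝ) (x : ℝ) :
    wronskian k (fun i => f (σ i)) x = (Equiv.Perm.sign σ : ℤ) * wronskian k f x := by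
  unfold _root_.wronskian
  rw [← Matrix.det_permute']
  rfl

theorem derivative_hermiteH_succ (n : ℕ) :
    derivative (hermiteH (n + 1)) = C (2 * ((n : ℝ) + 1)) * hermiteH n := by
  induction n with
  | zero => simp [hermiteH, Polynomial.derivative_mul]; exact (map_ofNat C 2).symm
  | succ n ih =>
    have e1 : hermiteH (n + 1 + 1) =
        2 * X * hermiteH (n + 1) - derivative (hermiteH (n + 1)) := rfl
    have e2 : hermiteH (n + 1) = 2 * X * hermiteH n - derivative (hermiteH n) := rfl
    have h2 : derivative (2 * X : ℝ[X]) = 2 := by simp [Polynomial.derivative_mul]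
    rw [e1, derivative_sub, derivative_mul, h2, ih, derivative_C_mul]
    have hC : (C (2 * (((n + 1 : ℕ) : ℝ) + 1)) : ℝ[X]) = C (2 * ((n : ℝ) + 1)) + 2 := by
      rw [← map_ofNat C 2, ← C_add]; congr 1; push_cast; ring
    rw [hC]
    linear_combination (-C (2 * ((n : ℝ) + 1))) * e2

theorem derivative_hermiteTwist_succ (n : ℕ) :
    derivative (hermiteTwist (n + 1)) = C (2 * ((n : ℝ) + 1)) * hermiteTwist n := by
  induction n with
  | zero => simp [hermiteTwist, Polynomial.derivative_mul]; exact (map_ofNat C 2).symm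
  | succ n ih =>
    have e1 : hermiteTwist (n + 1 + 1) =
        2 * X * hermiteTwist (n + 1) + derivative (hermiteTwist (n + 1)) := rfl
    have e2 : hermiteTwist (n + 1) =
        2 * X * hermiteTwist n + derivative (hermiteTwist n) := rfl
    have h2 : derivative (2 * X : ℝ[X]) = 2 := by simp [Polynomial.derivative_mul]
    rw [e1, derivative_add, derivative_mul, h2, ih, derivative_C_mul]
    have hC : (C (2 * (((n + 1 : ℕ) : ℝ) + 1)) : ℝ[X]) = C (2 * ((n : ℝ) + 1)) + 2 := by
      rw [← map_ofNat C 2, ← C_add]; congr 1; push_cast; ring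
    rw [hC]
    linear_combination (-C (2 * ((n : ℝ) + 1))) * e2

/-- Eigenfunctions and pseudo virtual states as a single family indexed by the integers:
`φ_k` at `k ≥ 0` and `φ̃_v` at `-1 - v`. -/
noncomputable def oscillatorState : ℤ → ℝ → ℝ
  | Int.ofNat k => phiEigen k
  | Int.negSucc v => phiTilde v

theorem contDiff_oscillatorState (m : ℤ) : ContDiff ℝ (⊤ : ℕ∞) (oscillatorState m) := by
  rcases m with k | v
  · change ContDiff ℝ _ fun x => Real.exp (-(x ^ 2) / 2) * (hermiteH k).eval x
    exact (by fun_prop : ContDiff ℝ _ fun x : ℝ => Real.exp (-(x ^ 2) / 2)).mul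
      (by simpa using (hermiteH k).contDiff_aeval (𝕜 := ℝ) _)
  · change ContDiff ℝ _ fun x => Real.exp (x ^ 2 / 2) * (hermiteTwist v).eval x
    exact (by fun_prop : ContDiff ℝ _ fun x : ℝ => Real.exp (x ^ 2 / 2)).mul
      (by simpa using (hermiteTwist v).contDiff_aeval (𝕜 := ℝ) _)

theorem exp_half_sq_mul_exp_neg (y : ℝ) : Real.exp (y ^ 2 / 2) * Real.exp (-(y ^ 2) / 2) = 1 := by
  rw [← Real.exp_add, ← Real.exp_zero]
  congr 1
  ring

theorem hasDerivAt_exp_sq_mul (p : ℝ[X]) (y : ℝ) :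
    HasDerivAt (fun y => Real.exp (y ^ 2 / 2) * (Real.exp (y ^ 2 / 2) * p.eval y))
      (Real.exp (y ^ 2 / 2) * (Real.exp (y ^ 2 / 2) * (2 * X * p + derivative p).eval y)) y := by
  have h1 : HasDerivAt (fun y : ℝ => Real.exp (y ^ 2 / 2)) (Real.exp (y ^ 2 / 2) * y) y := by
    refine ((hasDerivAt_pow 2 y).div_const 2).exp.congr_deriv ?_
    norm_num
  refine (h1.mul (h1.mul (p.hasDerivAt y))).congr_deriv ?_
  simp only [Pi.mul_apply, eval_add, eval_mul, eval_ofNat, eval_X]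
  ring

theorem hasDerivAt_exp_neg_sq_mul (p : ℝ[X]) (y : ℝ) :
    HasDerivAt (fun y => Real.exp (-(y ^ 2) / 2) * (Real.exp (-(y ^ 2) / 2) * p.eval y))
      (-(Real.exp (-(y ^ 2) / 2) *
        (Real.exp (-(y ^ 2) / 2) * (2 * X * p - derivative p).eval y))) y := by
  have h1 : HasDerivAt (fun y : ℝ => Real.exp (-(y ^ 2) / 2))
      (-(Real.exp (-(y ^ 2) / 2) * y)) y := by
    refine ((hasDerivAt_pow 2 y).fun_neg.div_const 2).exp.congr_deriv ?_
    norm_num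
    ring
  refine (h1.mul (h1.mul (p.hasDerivAt y))).congr_deriv ?_
  simp only [Pi.mul_apply, eval_sub, eval_mul, eval_ofNat, eval_X]
  ring

/-- Lowering relation, away from the ground state. -/
theorem exists_deriv_exp_mul_oscillatorState (m : ℤ) (hm : m ≠ -1) :
    ∃ c : ℝ, c ≠ 0 ∧ deriv (fun y => Real.exp (y ^ 2 / 2) * oscillatorState (m + 1) y) =
      fun y => c * (Real.exp (y ^ 2 / 2) * oscillatorState m y) := by
  rcases m with k | v
  · refine ⟨2 * ((k : ℝ) + 1), by positivity, ?_⟩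
    have h1 : (fun y => Real.exp (y ^ 2 / 2) * oscillatorState (Int.ofNat k + 1) y) =
        fun y => (hermiteH (k + 1)).eval y := by
      funext y
      change Real.exp (y ^ 2 / 2) * (Real.exp (-(y ^ 2) / 2) * (hermiteH (k + 1)).eval y) = _
      rw [← mul_assoc, exp_half_sq_mul_exp_neg, one_mul]
    rw [h1]
    funext y
    change _ = 2 * ((k : ℝ) + 1) *
      (Real.exp (y ^ 2 / 2) * (Real.exp (-(y ^ 2) / 2) * (hermiteH k).eval y))
    rw [← mul_assoc (Real.exp _), exp_half_sq_mul_exp_neg, one_mul, Polynomial.deriv,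
      derivative_hermiteH_succ, eval_mul, eval_C]
  · obtain _ | v := v
    · exact absurd rfl hm
    · refine ⟨1, one_ne_zero, ?_⟩
      have h1 : Int.negSucc (v + 1) + 1 = Int.negSucc v := by omega
      rw [h1]
      funext y
      rw [one_mul]
      exact (hasDerivAt_exp_sq_mul (hermiteTwist v) y).deriv

/-- Raising relation, away from the lowest pseudo virtual state. -/
theorem exists_deriv_exp_neg_mul_oscillatorState (m : ℤ) (hm : m ≠ -1) :
    ∃ c : ℝ, c ≠ 0 ∧ deriv (fun y => Real.exp (-(y ^ 2) / 2) * oscillatorState m y) =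
      fun y => c * (Real.exp (-(y ^ 2) / 2) * oscillatorState (m + 1) y) := by
  rcases m with k | v
  · refine ⟨-1, by norm_num, ?_⟩
    funext y
    rw [neg_one_mul]
    exact (hasDerivAt_exp_neg_sq_mul (hermiteH k) y).deriv
  · obtain _ | v := v
    · exact absurd rfl hm
    · refine ⟨2 * ((v : ℝ) + 1), by positivity, ?_⟩
      have h1 : Int.negSucc (v + 1) + 1 = Int.negSucc v := by omega
      have h2 : (fun y => Real.exp (-(y ^ 2) / 2) * oscillatorState (Int.negSucc (v + 1)) y) =
          fun y => (hermiteTwist (v + 1)).eval y := by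
        funext y
        change Real.exp (-(y ^ 2) / 2) *
          (Real.exp (y ^ 2 / 2) * (hermiteTwist (v + 1)).eval y) = _
        rw [← mul_assoc, mul_comm (Real.exp _), exp_half_sq_mul_exp_neg, one_mul]
      rw [h1, h2]
      funext y
      change _ = 2 * ((v : ℝ) + 1) *
        (Real.exp (-(y ^ 2) / 2) * (Real.exp (y ^ 2 / 2) * (hermiteTwist v).eval y))
      rw [← mul_assoc (Real.exp _), mul_comm (Real.exp _), exp_half_sq_mul_exp_neg, one_mul,
        Polynomial.deriv, derivative_hermiteTwist_succ, eval_mul, eval_C]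

theorem exists_wronskian_shift_of_notMem (k : ℕ) (s : Fin k → ℤ) (hs : ∀ i, s i ≠ -1) :
    ∃ c : ℝ, c ≠ 0 ∧ ∀ x,
      Real.exp (x ^ 2 / 2) * wronskian (k + 1)
        (Fin.cons (oscillatorState 0) fun i => oscillatorState (s i + 1)) x =
      c * wronskian k (fun i => oscillatorState (s i)) x := by
  choose c hc h using fun i => exists_deriv_exp_mul_oscillatorState (s i) (hs i)
  refine ⟨∏ i, c i, Finset.prod_ne_zero_iff.2 fun i _ => hc i, fun x => ?_⟩
  refine wronskian_cons_of_gauge k (fun y => Real.exp (y ^ 2 / 2)) (by fun_prop) _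
    (contDiff_oscillatorState _) (fun y => ?_) _ (fun i => contDiff_oscillatorState _) _
    (fun i => contDiff_oscillatorState _) c h x
  change Real.exp (y ^ 2 / 2) * (Real.exp (-(y ^ 2) / 2) * (1 : ℝ[X]).eval y) = 1
  rw [eval_one, mul_one, exp_half_sq_mul_exp_neg]

theorem exists_wronskian_shift_of_mem (k : ℕ) (s : Fin k → ℤ) (hs : ∀ i, s i ≠ -1) :
    ∃ c : ℝ, c ≠ 0 ∧ ∀ x,
      Real.exp (-(x ^ 2) / 2) * wronskian (k + 1)
        (Fin.cons (oscillatorState (-1)) fun i => oscillatorState (s i)) x =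
      c * wronskian k (fun i => oscillatorState (s i + 1)) x := by
  choose c hc h using fun i => exists_deriv_exp_neg_mul_oscillatorState (s i) (hs i)
  refine ⟨∏ i, c i, Finset.prod_ne_zero_iff.2 fun i _ => hc i, fun x => ?_⟩
  refine wronskian_cons_of_gauge k (fun y => Real.exp (-(y ^ 2) / 2)) (by fun_prop) _
    (contDiff_oscillatorState _) (fun y => ?_) _ (fun i => contDiff_oscillatorState _) _
    (fun i => contDiff_oscillatorState _) c h x
  change Real.exp (-(y ^ 2) / 2) * (Real.exp (y ^ 2 / 2) * (1 : ℝ[X]).eval y) = 1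
  rw [eval_one, mul_one, mul_comm, exp_half_sq_mul_exp_neg]

/-- The Wronskian of the states indexed by a finite set of integers. -/
noncomputable def stateWronskian (S : Finset ℤ) (x : ℝ) : ℝ :=
  wronskian S.card (fun i => oscillatorState (S.orderEmbOfFin rfl i)) x

theorem exists_wronskian_eq_stateWronskian (k : ℕ) (s : Fin k → ℤ) (hs : Function.Injective s)
    (S : Finset ℤ) (hS : ∀ z, z ∈ S ↔ ∃ i, s i = z) :
    ∃ c : ℝ, c ≠ 0 ∧ ∀ x,
      wronskian k (fun i => oscillatorState (s i)) x = c * stateWronskian S x := by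
  have himg : S = Finset.univ.image s := by
    ext z
    simp [hS]
  obtain rfl : S.card = k := by
    rw [himg, Finset.card_image_of_injective _ hs, Finset.card_fin]
  have hex : ∀ i, ∃ j, S.orderEmbOfFin rfl j = s i := by
    intro i
    have : s i ∈ Set.range (S.orderEmbOfFin rfl) := by
      rw [Finset.range_orderEmbOfFin]
      exact (hS _).2 ⟨i, rfl⟩
    exact this
  choose σ hσ using hex
  have hinj : Function.Injective σ := fun a b hab => hs (by rw [← hσ a, ← hσ b, hab])
  let τ : Equiv.Perm (Fin S.card) := Equiv.ofBijective σ (Finite.injective_iff_bijective.1 hinj)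
  refine ⟨(Equiv.Perm.sign τ : ℤ), by simp, fun x => ?_⟩
  rw [stateWronskian, ← wronskian_comp_perm]
  congr 1
  funext i
  rw [← hσ i]
  rfl

/-- Shifting the Maya diagram of occupied states by one unit. -/
theorem exists_stateWronskian_shift (S T : Finset ℤ)
    (hT : ∀ z, z ∈ T ↔ ¬ (z - 1 ∈ S ↔ z = 0)) :
    ∃ c : ℝ, c ≠ 0 ∧ ∀ x,
      stateWronskian S x = c * (Real.exp (x ^ 2 / 2) * stateWronskian T x) := by
  set R := S.erase (-1) with hR
  let s : Fin R.card → ℤ := R.orderEmbOfFin rfl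
  have hs : Function.Injective s := (R.orderEmbOfFin rfl).injective
  have hmem : ∀ z, z ∈ R ↔ ∃ i, s i = z := by
    intro z
    rw [← Finset.mem_coe, ← Finset.range_orderEmbOfFin R rfl]
    rfl
  have hs1 : ∀ i, s i ≠ -1 := fun i => Finset.ne_of_mem_erase ((hmem _).2 ⟨i, rfl⟩)
  have hRS : ∀ z, z ≠ -1 → (z ∈ S ↔ ∃ i, s i = z) := by
    intro z hz
    rw [← hmem, hR, Finset.mem_erase]
    tauto
  have hshift : ∀ z, (∃ i, s i + 1 = z) ↔ ∃ i, s i = z - 1 := fun z =>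
    exists_congr fun i => eq_sub_iff_add_eq.symm
  have hs' : Function.Injective fun i => s i + 1 := fun a b hab => hs (add_right_cancel hab)
  by_cases h : (-1 : ℤ) ∈ S
  · obtain ⟨c, hc, hW⟩ := exists_wronskian_shift_of_mem _ s hs1
    obtain ⟨a, ha, hWa⟩ := exists_wronskian_eq_stateWronskian _ (Fin.cons (-1) s)
      (Fin.cons_injective_iff.2 ⟨fun ⟨i, hi⟩ => hs1 i hi, hs⟩) S (by
        intro z
        rw [Fin.exists_fin_succ]
        simp only [Fin.cons_zero, Fin.cons_succ]
        by_cases hz : z = -1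
        · subst hz; simpa using h
        · rw [hRS z hz]
          exact ⟨Or.inr, fun h => h.resolve_left fun h' => hz h'.symm⟩)
    obtain ⟨b, hb, hWb⟩ := exists_wronskian_eq_stateWronskian _ _ hs' T (by
        intro z
        rw [hshift, hT]
        by_cases hz : z = 0
        · subst hz
          simpa [h] using hs1
        · rw [hRS _ (by omega)]
          tauto)
    refine ⟨c * b / a, by positivity, fun x => ?_⟩
    have hcons : (Fin.cons (oscillatorState (-1)) fun i => oscillatorState (s i)) =
        fun i => oscillatorState ((Fin.cons (-1) s : Fin (R.card + 1) → ℤ) i) := by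
      funext i
      refine Fin.cases ?_ (fun j => ?_) i <;> simp
    have h1 := hW x
    rw [hcons, hWa, hWb] at h1
    field_simp
    linear_combination Real.exp (x ^ 2 / 2) * h1 -
      a * stateWronskian S x * exp_half_sq_mul_exp_neg x
  · obtain ⟨c, hc, hW⟩ := exists_wronskian_shift_of_notMem _ s hs1
    obtain ⟨a, ha, hWa⟩ := exists_wronskian_eq_stateWronskian _
      (Fin.cons 0 fun i => s i + 1 : Fin (R.card + 1) → ℤ)
      (Fin.cons_injective_iff.2 ⟨fun ⟨i, hi⟩ => hs1 i (eq_neg_of_add_eq_zero_left hi), hs'⟩) T (by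
        intro z
        rw [Fin.exists_fin_succ, hT]
        simp only [Fin.cons_zero, Fin.cons_succ]
        rw [hshift]
        by_cases hz : z = 0
        · subst hz; simpa using h
        · rw [hRS _ (by omega)]
          have : ¬ (0 = z) := fun h => hz h.symm
          tauto)
    obtain ⟨b, hb, hWb⟩ := exists_wronskian_eq_stateWronskian _ s hs S (by
        intro z
        by_cases hz : z = -1
        · subst hz
          simpa [h] using hs1
        · exact hRS z hz)
    refine ⟨a / (c * b), by positivity, fun x => ?_⟩
    have hcons : (Fin.cons (oscillatorState 0) fun i => oscillatorState (s i + 1)) =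
        fun i => oscillatorState ((Fin.cons 0 fun i => s i + 1 : Fin (R.card + 1) → ℤ) i) := by
      funext i
      refine Fin.cases ?_ (fun j => ?_) i <;> simp
    have h1 := hW x
    rw [hcons, hWa, hWb] at h1
    field_simp
    linear_combination -h1

theorem exists_stateWronskian_shift_nat (L : ℕ) (S T : Finset ℤ)
    (hT : ∀ z, z ∈ T ↔ ¬ (z - L ∈ S ↔ 0 ≤ z ∧ z < L)) :
    ∃ c : ℝ, c ≠ 0 ∧ ∀ x,
      stateWronskian S x = c * (Real.exp (x ^ 2 / 2) ^ L * stateWronskian T x) := by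
  induction L generalizing T with
  | zero =>
    obtain rfl : T = S := by
      ext z
      rw [hT]
      have : ¬ (0 ≤ z ∧ z < ((0 : ℕ) : ℤ)) := by omega
      rw [Nat.cast_zero] at this ⊢
      rw [sub_zero]
      tauto
    exact ⟨1, one_ne_zero, fun x => by simp⟩
  | succ L ih =>
    classical
    let U : Finset ℤ := symmDiff (S.image (· + (L : ℤ))) (Finset.Ico 0 (L : ℤ))
    have hU : ∀ z, z ∈ U ↔ ¬ (z - L ∈ S ↔ 0 ≤ z ∧ z < L) := by
      intro z
      have : z ∈ S.image (· + (L : ℤ)) ↔ z - L ∈ S := by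
        simp [sub_eq_add_neg]
      rw [Finset.mem_symmDiff, this, Finset.mem_Ico]
      tauto
    obtain ⟨a, ha, hWa⟩ := ih U hU
    obtain ⟨b, hb, hWb⟩ := exists_stateWronskian_shift U T (by
      intro z
      rw [hT, hU]
      have e1 : z - ((L + 1 : ℕ) : ℤ) = z - 1 - L := by push_cast; ring
      have e2 : (0 ≤ z ∧ z < ((L + 1 : ℕ) : ℤ)) ↔ ((0 ≤ z - 1 ∧ z - 1 < L) ∨ z = 0) := by
        push_cast; omega
      have e3 : ¬ ((0 ≤ z - 1 ∧ z - 1 < L) ∧ z = 0) := by omega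
      rw [e1, e2]
      tauto)
    refine ⟨a * b, mul_ne_zero ha hb, fun x => ?_⟩
    rw [hWa, hWb]
    ring

/-- The Maya diagram shift, for arbitrary enumerations of the occupied states. -/
theorem exists_wronskian_shift_nat (L : ℕ) {k m : ℕ} (s : Fin k → ℤ) (hs : Function.Injective s)
    (t : Fin m → ℤ) (ht : Function.Injective t)
    (hst : ∀ z, (∃ i, t i = z) ↔ ¬ ((∃ j, s j = z - L) ↔ 0 ≤ z ∧ z < L)) :
    ∃ c : ℝ, c ≠ 0 ∧ ∀ x, wronskian k (fun i => oscillatorState (s i)) x =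
      c * (Real.exp (x ^ 2 / 2) ^ L * wronskian m (fun i => oscillatorState (t i)) x) := by
  classical
  obtain ⟨a, ha, hWa⟩ := exists_wronskian_eq_stateWronskian k s hs (Finset.univ.image s) (by simp)
  obtain ⟨b, hb, hWb⟩ := exists_wronskian_eq_stateWronskian m t ht (Finset.univ.image t) (by simp)
  obtain ⟨c, hc, hWc⟩ := exists_stateWronskian_shift_nat L (Finset.univ.image s)
    (Finset.univ.image t) (by simpa using hst)
  refine ⟨a * c / b, div_ne_zero (mul_ne_zero ha hc) hb, fun x => ?_⟩
  rw [hWa, hWb, hWc]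
  field_simp

theorem exists_snoc_eq_iff {k : ℕ} (r : Fin k → ℤ) (m z : ℤ) :
    (∃ i, (Fin.snoc r m : Fin (k + 1) → ℤ) i = z) ↔ (∃ i, r i = z) ∨ m = z := by
  rw [Fin.exists_fin_succ']
  simp

theorem snoc_oscillatorState {k : ℕ} (r : Fin k → ℤ) (m : ℤ) :
    (Fin.snoc (fun i => oscillatorState (r i)) (oscillatorState m) : Fin (k + 1) → ℝ → ℝ) =
      fun i => oscillatorState ((Fin.snoc r m : Fin (k + 1) → ℤ) i) := by
  funext i
  refine Fin.lastCases ?_ (fun j => ?_) i <;> simp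

/-- equivalence of the Darboux-Crum transformation in terms of pseudo
virtual states `{d₁,…,d_M}` with the Krein-Adler transformation deleting the
eigenstates `{N−d₁,…,N−d_M}` from the levels `{0,…,N}`, for the harmonic
oscillator: the produced eigenfunctions are proportional. -/
theorem harmonic_darboux_crum_krein_adler_eigenfunctions
    (M N n : ℕ) (d : Fin M → ℕ) (hd : Function.Injective d)
    (hdN : ∀ j, d j ≤ N)
    (e : Fin (N + 1 - M) → ℕ) (he : StrictMono e)
    (hrange : ∀ k : ℕ, (∃ i, e i = k) ↔ (k ≤ N ∧ ∀ j, k ≠ N - d j)) :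
    ∃ c : ℝ, c ≠ 0 ∧ ∀ x : ℝ,
      wronskian (M + 1) (Fin.snoc (fun j => phiTilde (d j)) (phiEigen n)) x
          * wronskian (N + 1 - M) (fun i => phiEigen (e i)) x
        = c * wronskian (N + 1 - M + 1)
              (Fin.snoc (fun i => phiEigen (e i)) (phiEigen (N + 1 + n))) x
            * wronskian M (fun j => phiTilde (d j)) x := by
  let s : Fin M → ℤ := fun j => Int.negSucc (d j)
  let t : Fin (N + 1 - M) → ℤ := fun i => (e i : ℤ)
  have hs : Function.Injective s := fun a b hab => hd (Int.negSucc.inj hab)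
  have ht : Function.Injective t := fun a b hab => he.injective (Int.ofNat.inj hab)
  have hs' : Function.Injective (Fin.snoc s (n : ℤ) : Fin (M + 1) → ℤ) :=
    Fin.snoc_injective_iff.2 ⟨hs, fun ⟨i, hi⟩ => by simp only [s] at hi; omega⟩
  have ht' : Function.Injective (Fin.snoc t ((N + 1 + n : ℕ) : ℤ) : Fin (N + 1 - M + 1) → ℤ) :=
    Fin.snoc_injective_iff.2 ⟨ht, fun ⟨i, hi⟩ => by
      have := ((hrange (e i)).1 ⟨i, rfl⟩).1
      simp only [t] at hi
      omega⟩
  have hS : ∀ z, (∃ j, s j = z - ((N + 1 : ℕ) : ℤ)) ↔ ∃ j, z = ((N - d j : ℕ) : ℤ) := by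
    intro z
    refine exists_congr fun j => ?_
    have := hdN j
    simp only [s]
    omega
  have hTmem : ∀ z, (∃ i, t i = z) ↔
      ¬ ((∃ j, s j = z - ((N + 1 : ℕ) : ℤ)) ↔ 0 ≤ z ∧ z < ((N + 1 : ℕ) : ℤ)) := by
    intro z
    rw [hS]
    by_cases hz : 0 ≤ z
    · lift z to ℕ using hz with k
      have h1 : (∃ i, t i = (k : ℤ)) ↔ ∃ i, e i = k :=
        exists_congr fun i => by simp only [t]; omega
      have h2 : (∃ j, (k : ℤ) = ((N - d j : ℕ) : ℤ)) ↔ ∃ j, k = N - d j :=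
        exists_congr fun j => by omega
      have h3 : (0 ≤ (k : ℤ) ∧ (k : ℤ) < ((N + 1 : ℕ) : ℤ)) ↔ k ≤ N := by omega
      have h4 : (∃ j, k = N - d j) → k ≤ N := fun ⟨j, hj⟩ => by omega
      rw [h1, h2, h3, hrange, ← not_exists]
      tauto
    · have h1 : ¬ ∃ i, t i = z := fun ⟨i, hi⟩ => by simp only [t] at hi; omega
      have h2 : ¬ ∃ j, z = ((N - d j : ℕ) : ℤ) := fun ⟨j, hj⟩ => by omega
      have h3 : ¬ (0 ≤ z ∧ z < ((N + 1 : ℕ) : ℤ)) := by omega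
      tauto
  obtain ⟨p, hp, hWp⟩ := exists_wronskian_shift_nat (N + 1) s hs t ht hTmem
  obtain ⟨q, hq, hWq⟩ := exists_wronskian_shift_nat (N + 1) _ hs' _ ht' (by
    intro z
    rw [exists_snoc_eq_iff, exists_snoc_eq_iff, hTmem]
    have h1 : ((n : ℤ) = z - ((N + 1 : ℕ) : ℤ)) ↔ ((N + 1 + n : ℕ) : ℤ) = z := by
      push_cast; omega
    have h2 : ((N + 1 + n : ℕ) : ℤ) = z → ¬ (0 ≤ z ∧ z < ((N + 1 : ℕ) : ℤ)) := by
      push_cast; omega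
    have h3 : ((N + 1 + n : ℕ) : ℤ) = z → ¬ ∃ j, s j = z - ((N + 1 : ℕ) : ℤ) := by
      rintro rfl ⟨j, hj⟩
      simp only [s] at hj
      push_cast at hj
      omega
    rw [h1]
    tauto)
  refine ⟨q / p, div_ne_zero hq hp, fun x => ?_⟩
  change wronskian (M + 1)
        (Fin.snoc (fun j => oscillatorState (s j)) (oscillatorState (n : ℤ))) x
      * wronskian (N + 1 - M) (fun i => oscillatorState (t i)) x
    = q / p * wronskian (N + 1 - M + 1) (Fin.snoc (fun i => oscillatorState (t i))
        (oscillatorState ((N + 1 + n : ℕ) : ℤ))) x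
      * wronskian M (fun j => oscillatorState (s j)) x
  rw [snoc_oscillatorState, snoc_oscillatorState, hWp, hWq]
  field_simp
end

section
/- Let d_1, …, d_M be distinct non-negative integers, let N be an integer with N ≥ max_j d_j, and let e_1 < … < e_{N+1−M} be the elements of {0, 1, …, N} \ {N−d_1, …, N−d_M}. Set φ_k(x) = e^{−x²/2}·H_k(x) and φ̃_v(x) = e^{x²/2}·h̃_v(x). Then at every real x at which both Wronskians W[φ̃_{d_1}, …, φ̃_{d_M}](x) and W[φ_{e_1}, …, φ_{e_{N+1−M}}](x) are nonzero, d²/dx² ( log|W[φ̃_{d_1}, …, φ̃_{d_M}](x)| − log|W[φ_{e_1}, …, φ_{e_{N+1−M}}](x)| ) = N + 1. -/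
open Polynomial

/-- The common generalisation of `hermiteH` (`s = -1`) and `hermiteTwist` (`s = 1`). -/
noncomputable def hermiteFamily (s : ℝ) : ℕ → ℝ[X]
  | 0 => 1
  | n + 1 => 2 * X * hermiteFamily s n + C s * derivative (hermiteFamily s n)

theorem hermiteH_eq_hermiteFamily (n : ℕ) : hermiteH n = hermiteFamily (-1) n := by
  induction n with
  | zero => rfl
  | succ n ih => simp [hermiteH, hermiteFamily, ih, sub_eq_add_neg]

theorem hermiteTwist_eq_hermiteFamily (n : ℕ) : hermiteTwist n = hermiteFamily 1 n := by
  induction n with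
  | zero => rfl
  | succ n ih => simp [hermiteTwist, hermiteFamily, ih]

theorem derivative_hermiteFamily_succ (s : ℝ) (n : ℕ) :
    derivative (hermiteFamily s (n + 1)) = C (2 * (n + 1 : ℝ)) * hermiteFamily s n := by
  induction n with
  | zero => simp [hermiteFamily, map_ofNat]
  | succ n ih =>
    rw [hermiteFamily, derivative_add, derivative_mul, derivative_C_mul, ih, derivative_C_mul]
    conv_rhs => rw [hermiteFamily]
    rw [hermiteFamily]
    simp only [derivative_mul, derivative_ofNat, derivative_X, map_mul, map_add, map_natCast,
      map_ofNat, map_one, Nat.cast_add, Nat.cast_one]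
    ring

theorem iterate_derivative_hermiteFamily (s : ℝ) (j n : ℕ) :
    derivative^[j] (hermiteFamily s n) =
      C (2 ^ j * (n.descFactorial j : ℝ)) * hermiteFamily s (n - j) := by
  induction j with
  | zero => simp
  | succ j ih =>
    rw [Function.iterate_succ_apply', ih, derivative_C_mul, Nat.descFactorial_succ]
    rcases Nat.lt_or_ge j n with h | h
    · obtain ⟨m, rfl⟩ : ∃ m, n = j + m + 1 := ⟨n - j - 1, by omega⟩
      rw [show j + m + 1 - j = m + 1 by omega, show j + m + 1 - (j + 1) = m by omega,
        derivative_hermiteFamily_succ, ← mul_assoc, ← C_mul]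
      congr 2
      push_cast
      ring
    · rw [Nat.sub_eq_zero_of_le h]
      simp [hermiteFamily]

theorem eval_hermiteFamily_succ_succ (s x : ℝ) (n : ℕ) :
    (hermiteFamily s (n + 2)).eval x =
      2 * x * (hermiteFamily s (n + 1)).eval x
        + 2 * s * (n + 1) * (hermiteFamily s n).eval x := by
  rw [hermiteFamily, derivative_hermiteFamily_succ]
  simp
  ring

theorem eval_neg_hermiteFamily (s x : ℝ) (n : ℕ) :
    (hermiteFamily s n).eval (-x) = (-1) ^ n * (hermiteFamily s n).eval x := by
  induction n using Nat.twoStepInduction with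
  | zero => simp [hermiteFamily]
  | one => simp [hermiteFamily]
  | more n ih₀ ih₁ =>
    rw [eval_hermiteFamily_succ_succ, eval_hermiteFamily_succ_succ, ih₀, ih₁]
    ring

/-- The Taylor coefficients in `t` of `exp (2 * x * t + s * t ^ 2)`. -/
noncomputable def hermiteCoeff (s x : ℝ) (n : ℕ) : ℝ :=
  (hermiteFamily s n).eval x / n.factorial

theorem eval_iterate_derivative_hermiteFamily (s x : ℝ) (j n : ℕ) :
    (derivative^[j] (hermiteFamily s n)).eval x =
      if j ≤ n then 2 ^ j * n.factorial * hermiteCoeff s x (n - j) else 0 := by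
  rw [iterate_derivative_hermiteFamily, eval_C_mul]
  split_ifs with h
  · have h' := Nat.factorial_mul_descFactorial h
    rw [← h', hermiteCoeff]
    push_cast
    field_simp
  · simp [Nat.descFactorial_eq_zero_iff_lt.2 (not_le.1 h)]

theorem derivative_mk_hermiteCoeff (s x : ℝ) :
    PowerSeries.derivative ℝ (PowerSeries.mk (hermiteCoeff s x)) =
      (PowerSeries.C (2 * x) + PowerSeries.C (2 * s) * PowerSeries.X) *
        PowerSeries.mk (hermiteCoeff s x) := by
  ext n
  rw [PowerSeries.coeff_derivative, add_mul, map_add, PowerSeries.coeff_C_mul,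
    mul_assoc (PowerSeries.C (2 * s)), PowerSeries.coeff_C_mul]
  cases n with
  | zero => simp [hermiteCoeff, hermiteFamily]
  | succ n =>
    rw [PowerSeries.coeff_succ_X_mul]
    simp only [PowerSeries.coeff_mk, hermiteCoeff, eval_hermiteFamily_succ_succ,
      Nat.factorial_succ]
    push_cast
    field_simp

theorem mk_hermiteCoeff_mul_mk_hermiteCoeff_neg (s x : ℝ) :
    PowerSeries.mk (hermiteCoeff s x) * PowerSeries.mk (hermiteCoeff (-s) (-x)) = 1 := by
  apply PowerSeries.derivative.ext
  · rw [Derivation.leibniz, derivative_mk_hermiteCoeff, derivative_mk_hermiteCoeff,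
      PowerSeries.derivative_one]
    simp only [smul_eq_mul, mul_neg, map_neg]
    ring
  · simp [hermiteCoeff, hermiteFamily]

theorem sum_hermiteCoeff_mul_hermiteCoeff_neg (s x : ℝ) (m : ℕ) :
    ∑ i ∈ Finset.range (m + 1), hermiteCoeff s x i * hermiteCoeff (-s) (-x) (m - i) =
      if m = 0 then 1 else 0 := by
  have h := congrArg (PowerSeries.coeff m) (mk_hermiteCoeff_mul_mk_hermiteCoeff_neg s x)
  rw [PowerSeries.coeff_mul, PowerSeries.coeff_one] at h
  simpa [Finset.Nat.sum_antidiagonal_eq_sum_range_succ_mk] using h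

/-- The Wronskian matrix at `x` of the first `n` members of the Hermite family. -/
noncomputable def hermiteMatrix (s x : ℝ) (n : ℕ) : Matrix (Fin n) (Fin n) ℝ :=
  Matrix.of fun j k => (derivative^[(j : ℕ)] (hermiteFamily s k)).eval x

/-- The explicit inverse of `hermiteMatrix`. -/
noncomputable def hermiteMatrixInv (s x : ℝ) (n : ℕ) : Matrix (Fin n) (Fin n) ℝ :=
  Matrix.of fun k j => if k ≤ j then
    hermiteCoeff (-s) (-x) (j - k) / ((k : ℕ).factorial * 2 ^ (j : ℕ)) else 0

theorem hermiteMatrix_mul_hermiteMatrixInv (s x : ℝ) (n : ℕ) :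
    hermiteMatrix s x n * hermiteMatrixInv s x n = 1 := by
  ext ⟨j, hj⟩ ⟨k, hk⟩
  simp only [Matrix.mul_apply, hermiteMatrix, hermiteMatrixInv, Matrix.of_apply, Fin.le_def,
    eval_iterate_derivative_hermiteFamily, Matrix.one_apply, Fin.mk.injEq]
  rw [Fin.sum_univ_eq_sum_range (fun i => (if j ≤ i then
    2 ^ j * (i.factorial : ℝ) * hermiteCoeff s x (i - j) else 0) * if i ≤ k then
      hermiteCoeff (-s) (-x) (k - i) / (i.factorial * 2 ^ k) else 0)]
  rcases Nat.lt_or_ge k j with h | h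
  · rw [if_neg (by omega)]
    refine Finset.sum_eq_zero fun i _ => ?_
    split_ifs <;> first | omega | simp
  · obtain ⟨m, rfl⟩ := Nat.exists_eq_add_of_le h
    rw [← Finset.sum_subset (s₁ := Finset.Ico j (j + m + 1)), Finset.sum_Ico_eq_sum_range,
      show j + m + 1 - j = m + 1 by omega]
    · trans ((2 : ℝ) ^ m)⁻¹ *
        ∑ i ∈ Finset.range (m + 1), hermiteCoeff s x i * hermiteCoeff (-s) (-x) (m - i)
      · rw [Finset.mul_sum]
        refine Finset.sum_congr rfl fun i hi => ?_
        rw [Finset.mem_range] at hi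
        rw [if_pos (by omega), if_pos (by omega), Nat.add_sub_cancel_left,
          Nat.add_sub_add_left, pow_add]
        field_simp
      · rw [sum_hermiteCoeff_mul_hermiteCoeff_neg]
        rcases eq_or_ne m 0 with rfl | hm <;> simp [*]
    · intro i hi
      simp only [Finset.mem_Ico, Finset.mem_range] at hi ⊢
      omega
    · intro i _ hi
      rw [Finset.mem_Ico] at hi
      split_ifs <;> first | omega | simp

theorem det_hermiteMatrix (s x : ℝ) (n : ℕ) :
    (hermiteMatrix s x n).det = ∏ i : Fin n, 2 ^ (i : ℕ) * ((i : ℕ).factorial : ℝ) := by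
  rw [Matrix.det_of_isUpperTriangular]
  · simp [hermiteMatrix, eval_iterate_derivative_hermiteFamily, hermiteCoeff, hermiteFamily]
  · intro i j hij
    simp only [id] at hij
    simp [hermiteMatrix, eval_iterate_derivative_hermiteFamily, hij]

theorem le_succ_of_injective {M N : ℕ} {d : Fin M → ℕ} (hd : Function.Injective d)
    (hdN : ∀ j, d j ≤ N) : M ≤ N + 1 := by
  simpa using Fintype.card_le_of_injective
    (fun j => (⟨d j, Nat.lt_succ_of_le (hdN j)⟩ : Fin (N + 1)))
    fun i j h => hd (by simpa using h)

theorem Matrix.det_submatrix_equiv {m n R : Type*} [Fintype m] [DecidableEq m] [Fintype n]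
    [DecidableEq n] [CommRing R] (A : Matrix n n R) (σ τ : m ≃ n) :
    (A.submatrix σ τ).det = Equiv.Perm.sign (τ.trans σ.symm) * A.det := by
  rw [← Matrix.det_submatrix_equiv_self σ A, ← Matrix.det_permute']
  congr 1
  ext i j
  simp

/-- **Jacobi's complementary minor theorem** in block form. -/
theorem Matrix.det_mul_det_toBlocks₂₂ {m n R : Type*} [Fintype m] [DecidableEq m] [Fintype n]
    [DecidableEq n] [CommRing R] {A B : Matrix (m ⊕ n) (m ⊕ n) R} (h : A * B = 1) :
    A.det * B.toBlocks₂₂.det = A.toBlocks₁₁.det := by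
  have hb : A * Matrix.fromBlocks 1 B.toBlocks₁₂ 0 B.toBlocks₂₂ =
      Matrix.fromBlocks A.toBlocks₁₁ 0 A.toBlocks₂₁ 1 := by
    rw [← Matrix.fromBlocks_toBlocks A, ← Matrix.fromBlocks_toBlocks B,
      Matrix.fromBlocks_multiply, ← Matrix.fromBlocks_one, Matrix.fromBlocks_inj] at h
    conv_lhs => rw [← Matrix.fromBlocks_toBlocks A]
    rw [Matrix.fromBlocks_multiply, h.2.1, h.2.2.2]
    simp
  have hd := congrArg Matrix.det hb
  rwa [Matrix.det_mul, Matrix.det_fromBlocks_zero₂₁, Matrix.det_fromBlocks_zero₁₂,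
    Matrix.det_one, Matrix.det_one, one_mul, mul_one] at hd

theorem iteratedDeriv_polynomial_eval (p : ℝ[X]) (j : ℕ) :
    iteratedDeriv j (fun x => p.eval x) = fun x => (derivative^[j] p).eval x := by
  induction j with
  | zero => simp
  | succ j ih =>
    rw [iteratedDeriv_succ, ih, Function.iterate_succ_apply']
    ext x
    exact Polynomial.deriv _

theorem wronskian_mul_right {n : ℕ} {g : ℝ → ℝ} {f : Fin n → ℝ → ℝ} (hg : ContDiff ℝ n g)
    (hf : ∀ i, ContDiff ℝ n (f i)) (x : ℝ) :
    _root_.wronskian n (fun i y => f i y * g y) x = g x ^ n * _root_.wronskian n f x := by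
  let L : Matrix (Fin n) (Fin n) ℝ := Matrix.of fun j i =>
    if (i : ℕ) ≤ j then ((j : ℕ).choose i : ℝ) * iteratedDeriv (j - i : ℕ) g x else 0
  have hL : L.det = g x ^ n := by
    rw [Matrix.det_of_isLowerTriangular]
    · simp [L]
    · intro i j hij
      have hij' : (i : ℕ) < j := hij
      simp only [L, Matrix.of_apply, if_neg (not_le.2 hij')]
  rw [← hL, _root_.wronskian, _root_.wronskian, ← Matrix.det_mul]
  congr 1
  ext j k
  have hj : ((j : ℕ) : WithTop ℕ∞) ≤ n := by exact_mod_cast j.2.le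
  rw [Matrix.of_apply, iteratedDeriv_fun_mul ((hf k).of_le hj).contDiffAt
    (hg.of_le hj).contDiffAt, Matrix.mul_apply]
  simp only [L, Matrix.of_apply]
  rw [Fin.sum_univ_eq_sum_range (fun i => (if i ≤ (j : ℕ) then
    ((j : ℕ).choose i : ℝ) * iteratedDeriv (j - i : ℕ) g x else 0) * iteratedDeriv i (f k) x)]
  rw [← Finset.sum_subset (Finset.range_mono (Nat.succ_le_of_lt j.2))]
  · refine Finset.sum_congr rfl fun i hi => ?_
    rw [if_pos (by rw [Finset.mem_range] at hi; omega)]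
    ring
  · intro i _ hi
    rw [if_neg (by rw [Finset.mem_range] at hi; omega), zero_mul]

/-- Complementary Wronskians of the families `hermiteFamily s` and `hermiteFamily (-s)` are
proportional. -/
theorem exists_wronskian_hermiteFamily_eq (s : ℝ) {M N : ℕ} {d : Fin M → ℕ}
    (hd : Function.Injective d) (hdN : ∀ j, d j ≤ N) {e : Fin (N + 1 - M) → ℕ}
    (he : Function.Injective e) (heN : ∀ i, e i ≤ N) (hed : ∀ i j, e i ≠ N - d j) :
    ∃ c : ℝ, ∀ x : ℝ,
      _root_.wronskian (N + 1 - M) (fun i y => (hermiteFamily s (e i)).eval y) x =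
        c * _root_.wronskian M (fun j y => (hermiteFamily (-s) (d j)).eval y) x := by
  have hM : M ≤ N + 1 := le_succ_of_injective hd hdN
  let σ₀ : Fin (N + 1 - M) ⊕ Fin M → Fin (N + 1) :=
    Sum.elim (fun j => ⟨j, by omega⟩) (fun l => ⟨N - l, by omega⟩)
  let τ₀ : Fin (N + 1 - M) ⊕ Fin M → Fin (N + 1) :=
    Sum.elim (fun i => ⟨e i, Nat.lt_succ_of_le (heN i)⟩) (fun j => ⟨N - d j, by omega⟩)
  have hcard : Fintype.card (Fin (N + 1 - M) ⊕ Fin M) = Fintype.card (Fin (N + 1)) := by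
    simp [Nat.sub_add_cancel hM]
  have hσ : Function.Bijective σ₀ := by
    rw [Fintype.bijective_iff_injective_and_card]
    refine ⟨Function.Injective.sumElim ?_ ?_ ?_, hcard⟩
    · intro a b h
      simpa [Fin.ext_iff] using h
    · intro a b h
      simp only [Fin.mk.injEq] at h
      omega
    · intro a b h
      simp only [Fin.mk.injEq] at h
      omega
  have hτ : Function.Bijective τ₀ := by
    rw [Fintype.bijective_iff_injective_and_card]
    refine ⟨Function.Injective.sumElim ?_ ?_ ?_, hcard⟩
    · intro a b h
      exact he (by simpa using h)
    · intro a b h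
      simp only [Fin.mk.injEq] at h
      have ha := hdN a
      have hb := hdN b
      exact hd (by omega)
    · intro a b h
      exact hed a b (by simpa using h)
  let σ := Equiv.ofBijective σ₀ hσ
  let τ := Equiv.ofBijective τ₀ hτ
  refine ⟨Equiv.Perm.sign (τ.trans σ.symm) *
    (∏ i : Fin (N + 1), 2 ^ (i : ℕ) * ((i : ℕ).factorial : ℝ)) *
    ((∏ i, (-1 : ℝ) ^ d i / ((N - d i).factorial * (d i).factorial)) *
      ∏ l : Fin M, (-1 : ℝ) ^ (l : ℕ) / 2 ^ N), fun x => ?_⟩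
  have hAB : (hermiteMatrix s x (N + 1)).submatrix σ τ *
      (hermiteMatrixInv s x (N + 1)).submatrix τ σ = 1 := by
    rw [Matrix.submatrix_mul_equiv, hermiteMatrix_mul_hermiteMatrixInv,
      Matrix.submatrix_one_equiv]
  have hA : ((hermiteMatrix s x (N + 1)).submatrix σ τ).toBlocks₁₁.det =
      _root_.wronskian (N + 1 - M) (fun i y => (hermiteFamily s (e i)).eval y) x := by
    rw [_root_.wronskian]
    congr 1
    ext j i
    simp [hermiteMatrix, σ, τ, σ₀, τ₀, iteratedDeriv_polynomial_eval, Matrix.toBlocks₁₁]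
  have hB : ((hermiteMatrixInv s x (N + 1)).submatrix τ σ).toBlocks₂₂.det =
      (∏ i, (-1 : ℝ) ^ d i / ((N - d i).factorial * (d i).factorial)) *
        ((∏ l : Fin M, (-1 : ℝ) ^ (l : ℕ) / 2 ^ N) *
          _root_.wronskian M (fun j y => (hermiteFamily (-s) (d j)).eval y) x) := by
    rw [_root_.wronskian, ← Matrix.det_transpose (Matrix.of _), ← Matrix.det_mul_row,
      ← Matrix.det_mul_column]
    congr 1
    ext i l
    have hi := hdN i
    have hle : N - d i ≤ N - l ↔ (l : ℕ) ≤ d i := by omega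
    simp only [hermiteMatrixInv, σ, τ, σ₀, τ₀, iteratedDeriv_polynomial_eval, Matrix.toBlocks₂₂,
      Matrix.submatrix_apply, Matrix.of_apply, Equiv.ofBijective_apply, Sum.elim_inr,
      Matrix.transpose_apply, eval_iterate_derivative_hermiteFamily, Fin.mk_le_mk, hle]
    split_ifs with h
    · obtain ⟨m, hm⟩ := Nat.exists_eq_add_of_le h
      have hN : N = (N - l) + l := by omega
      rw [show N - l - (N - d i) = m by omega, show d i - l = m by omega, hermiteCoeff,
        hermiteCoeff, eval_neg_hermiteFamily]
      have h2 : (2 : ℝ) ^ N = 2 ^ (N - l : ℕ) * 2 ^ (l : ℕ) := by rw [← pow_add, ← hN]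
      have h1 : (-1 : ℝ) ^ d i * (-1) ^ (l : ℕ) = (-1) ^ m := by
        rw [hm, pow_add, mul_right_comm, ← mul_pow]
        simp
      rw [h2, ← h1]
      field_simp
    · simp
  rw [← hA, ← Matrix.det_mul_det_toBlocks₂₂ hAB, hB, Matrix.det_submatrix_equiv,
    det_hermiteMatrix]
  ring

theorem contDiff_eval {n : WithTop ℕ∞} (p : ℝ[X]) : ContDiff ℝ n (fun x => p.eval x) := by
  simpa using p.contDiff_aeval (𝕜 := ℝ) n

theorem wronskian_phiTilde {M : ℕ} (d : Fin M → ℕ) (x : ℝ) :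
    _root_.wronskian M (fun j => phiTilde (d j)) x =
      Real.exp (x ^ 2 / 2) ^ M *
        _root_.wronskian M (fun j y => (hermiteFamily 1 (d j)).eval y) x := by
  rw [← wronskian_mul_right (g := fun x => Real.exp (x ^ 2 / 2)) (by fun_prop)
    fun i => contDiff_eval _]
  congr
  ext j y
  rw [phiTilde, hermiteTwist_eq_hermiteFamily, mul_comm]

theorem wronskian_phiEigen {n : ℕ} (e : Fin n → ℕ) (x : ℝ) :
    _root_.wronskian n (fun i => phiEigen (e i)) x =
      Real.exp (-(x ^ 2) / 2) ^ n *
        _root_.wronskian n (fun i y => (hermiteFamily (-1) (e i)).eval y) x := by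
  rw [← wronskian_mul_right (g := fun x => Real.exp (-(x ^ 2) / 2)) (by fun_prop)
    fun i => contDiff_eval _]
  congr
  ext j y
  rw [phiEigen, hermiteH_eq_hermiteFamily, mul_comm]

theorem continuous_wronskian_phiTilde {M : ℕ} (d : Fin M → ℕ) :
    Continuous (_root_.wronskian M (fun j => phiTilde (d j))) := by
  rw [funext (wronskian_phiTilde d)]
  refine Continuous.mul (by fun_prop) (Continuous.matrix_det ?_)
  refine continuous_matrix fun j k => ?_
  simp only [Matrix.of_apply, iteratedDeriv_polynomial_eval]
  exact Polynomial.continuous _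

/-- equality of the deformed potentials for the harmonic oscillator:
wherever both Wronskians are nonzero,
`(log|W[φ̃_{d₁},…,φ̃_{d_M}]| − log|W[φ_{e₁},…,φ_{e_{N+1−M}}]|)'' = N + 1`. -/
theorem harmonic_darboux_crum_krein_adler_potentials
    (M N : ℕ) (d : Fin M → ℕ) (hd : Function.Injective d)
    (hdN : ∀ j, d j ≤ N)
    (e : Fin (N + 1 - M) → ℕ) (he : StrictMono e)
    (hrange : ∀ k : ℕ, (∃ i, e i = k) ↔ (k ≤ N ∧ ∀ j, k ≠ N - d j)) :
    ∀ x : ℝ,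
      wronskian M (fun j => phiTilde (d j)) x ≠ 0 →
      wronskian (N + 1 - M) (fun i => phiEigen (e i)) x ≠ 0 →
      deriv (deriv (fun y =>
          Real.log |wronskian M (fun j => phiTilde (d j)) y|
            - Real.log |wronskian (N + 1 - M) (fun i => phiEigen (e i)) y|)) x
        = N + 1 := by
  intro x hd_ne he_ne
  obtain ⟨c, hc⟩ := exists_wronskian_hermiteFamily_eq (-1) hd hdN he.injective
    (fun i => ((hrange _).1 ⟨i, rfl⟩).1) (fun i => ((hrange _).1 ⟨i, rfl⟩).2)
  rw [neg_neg] at hc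
  have hMN : M ≤ N + 1 := le_succ_of_injective hd hdN
  have hratio (y : ℝ) : _root_.wronskian (N + 1 - M) (fun i => phiEigen (e i)) y =
      c * Real.exp (-((N + 1 : ℝ) * y ^ 2 / 2)) *
        _root_.wronskian M (fun j => phiTilde (d j)) y := by
    rw [wronskian_phiEigen, wronskian_phiTilde, hc, ← Real.exp_nat_mul, ← Real.exp_nat_mul,
      show ((N + 1 - M : ℕ) : ℝ) * (-(y ^ 2) / 2) =
        -((N + 1 : ℝ) * y ^ 2 / 2) + M * (y ^ 2 / 2) by push_cast [Nat.cast_sub hMN]; ring,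
      Real.exp_add]
    ring
  have hc0 : c ≠ 0 := by
    rintro rfl
    exact he_ne (by rw [hratio]; ring)
  have hlog : (fun y => Real.log |_root_.wronskian M (fun j => phiTilde (d j)) y| -
      Real.log |_root_.wronskian (N + 1 - M) (fun i => phiEigen (e i)) y|) =ᶠ[nhds x]
      fun y => (N + 1 : ℝ) * y ^ 2 / 2 - Real.log c := by
    filter_upwards [(continuous_wronskian_phiTilde d).continuousAt.eventually_ne hd_ne] with y hy
    rw [hratio, Real.log_abs, Real.log_abs, Real.log_mul (by positivity) hy,
      Real.log_mul hc0 (Real.exp_ne_zero _), Real.log_exp]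
    ring
  rw [hlog.deriv.deriv_eq]
  have hderiv : deriv (fun y : ℝ => (N + 1 : ℝ) * y ^ 2 / 2 - Real.log c) =
      fun y => (N + 1 : ℝ) * y := by
    ext y
    have h := (((hasDerivAt_pow 2 y).const_mul (N + 1 : ℝ)).div_const 2).sub_const (Real.log c)
    rw [h.deriv]
    push_cast
    ring
  rw [hderiv]
  simp
end
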